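/- There exist universal constants C, c > 0 such that for all integers t ≥ 1, d ≥ 0 and every ε ∈ (0,1), there is a sample size m ≤ C·t(d+1)·(log(t(d+1)/ε))^c / ε² and a learning algorithm A using m samples over [−1,1) such that: for every ε/(64·t(d+1))-well-behaved probability distribution p over [−1,1), with probability at least 9/10 over m i.i.d. samples s drawn from p, A(s) is a (2t−1)-piecewise degree-d distribution over [−1,1) satisfying d_TV(p, A(s)) ≤ 3·opt_{t,d}(p)·(1+ε) + C·ε. (Theorem thm:piece-poly.) -/

import Mathlib

open MeasureTheory Set
open scoped ENNReal

noncomputable def tvDist (p q : Measure ℝ) : ℝ :=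
  ⨆ A : {S : Set ℝ // MeasurableSet S}, |(p A.1).toReal - (q A.1).toReal|

def IsPiecewisePoly (a b : ℝ) (t d : ℕ) (f : ℝ → ℝ) : Prop :=
  ∃ x : Fin (t + 1) → ℝ, x 0 = a ∧ x (Fin.last t) = b ∧ Monotone x ∧
    ∀ i : Fin t, ∃ P : Polynomial ℝ, P.natDegree ≤ d ∧
      ∀ y ∈ Set.Ico (x i.castSucc) (x i.succ), f y = P.eval y

def IsPiecewisePolyDist (q : Measure ℝ) (a b : ℝ) (t d : ℕ) : Prop :=
  IsProbabilityMeasure q ∧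
  ∃ f : ℝ → ℝ, (∀ y ∈ Set.Ico a b, 0 ≤ f y) ∧
    q = (volume.restrict (Set.Ico a b)).withDensity (fun y => ENNReal.ofReal (f y)) ∧
    IsPiecewisePoly a b t d f

noncomputable def optTD (p : Measure ℝ) (t d : ℕ) : ℝ :=
  sInf {x : ℝ | ∃ q : Measure ℝ, IsPiecewisePolyDist q (-1) 1 t d ∧ x = tvDist p q}

noncomputable def samples (p : Measure ℝ) (m : ℕ) : Measure (Fin m → ℝ) :=
  Measure.pi fun _ => p

lemma tvDist_le {p q : Measure ℝ} {c : ℝ}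
    (h : ∀ S, MeasurableSet S → |p.real S - q.real S| ≤ c) : tvDist p q ≤ c := by
  have : Nonempty {S : Set ℝ // MeasurableSet S} := ⟨⟨∅, MeasurableSet.empty⟩⟩
  exact ciSup_le fun A => h A.1 A.2

lemma abs_measureReal_sub_le_one (p q : Measure ℝ) [IsProbabilityMeasure p]
    [IsProbabilityMeasure q] (S : Set ℝ) : |p.real S - q.real S| ≤ 1 := by
  have h1 : p.real S ≤ 1 := measureReal_le_one
  have h2 : q.real S ≤ 1 := measureReal_le_one
  have h3 : 0 ≤ p.real S := measureReal_nonneg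
  have h4 : 0 ≤ q.real S := measureReal_nonneg
  rw [abs_le]
  constructor <;> linarith

lemma abs_measureReal_sub_le_tvDist (p q : Measure ℝ) [IsProbabilityMeasure p]
    [IsProbabilityMeasure q] {S : Set ℝ} (hS : MeasurableSet S) :
    |p.real S - q.real S| ≤ tvDist p q := by
  refine le_ciSup (f := fun A : {S : Set ℝ // MeasurableSet S} =>
    |(p A.1).toReal - (q A.1).toReal|) ⟨1, ?_⟩ ⟨S, hS⟩
  rintro _ ⟨A, rfl⟩
  exact abs_measureReal_sub_le_one p q A.1

lemma tvDist_nonneg (p q : Measure ℝ) [IsProbabilityMeasure p] [IsProbabilityMeasure q] :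
    0 ≤ tvDist p q :=
  (abs_nonneg _).trans (abs_measureReal_sub_le_tvDist p q MeasurableSet.empty)

lemma tvDist_le_one (p q : Measure ℝ) [IsProbabilityMeasure p] [IsProbabilityMeasure q] :
    tvDist p q ≤ 1 :=
  tvDist_le fun S _ => abs_measureReal_sub_le_one p q S

lemma tvDist_triangle (p q r : Measure ℝ) [IsProbabilityMeasure p] [IsProbabilityMeasure q]
    [IsProbabilityMeasure r] : tvDist p r ≤ tvDist p q + tvDist q r :=
  tvDist_le fun _ hS => (abs_sub_le _ _ _).trans
    (add_le_add (abs_measureReal_sub_le_tvDist p q hS) (abs_measureReal_sub_le_tvDist q r hS))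

/-- The fraction of the points of the sample `s` that lie in `B`. -/
noncomputable def empFreq {m : ℕ} (s : Fin m → ℝ) (B : Set ℝ) : ℝ :=
  (∑ i, B.indicator (fun _ => (1 : ℝ)) (s i)) / m

lemma empFreq_mono {m : ℕ} (s : Fin m → ℝ) {A B : Set ℝ} (h : A ⊆ B) :
    empFreq s A ≤ empFreq s B := by
  unfold empFreq
  gcongr

lemma measurable_empFreq {m : ℕ} {B : Set ℝ} (hB : MeasurableSet B) :
    Measurable fun s : Fin m → ℝ => empFreq s B := by
  unfold empFreq
  refine (Finset.measurable_sum _ fun i _ => ?_).div_const _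
  exact (measurable_const.indicator hB).comp (measurable_pi_apply i)

instance isProbabilityMeasure_samples (p : Measure ℝ) [IsProbabilityMeasure p] (m : ℕ) :
    IsProbabilityMeasure (samples p m) := by
  unfold samples
  infer_instance

lemma measureReal_sum_centered_ge_le (p : Measure ℝ) [IsProbabilityMeasure p] {m : ℕ}
    (hm : 0 < m) {X : ℝ → ℝ} (hX : Measurable X) {a : ℝ} (hb : ∀ x, X x ∈ Icc a (a + 1))
    {δ : ℝ} (hδ : 0 ≤ δ) :
    (samples p m).real {s | m * δ ≤ ∑ i, (X (s i) - ∫ x, X x ∂p)} ≤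
      Real.exp (-(2 * m * δ ^ 2)) := by
  have hind : ProbabilityTheory.iIndepFun
      (fun (i : Fin m) (s : Fin m → ℝ) => X (s i) - ∫ x, X x ∂p) (samples p m) :=
    ProbabilityTheory.iIndepFun_pi (μ := fun _ : Fin m => p)
      (X := fun _ x => X x - ∫ x, X x ∂p) fun i => (hX.sub_const _).aemeasurable
  have hsub : ∀ i ∈ (Finset.univ : Finset (Fin m)), ProbabilityTheory.HasSubgaussianMGF
      (fun s : Fin m → ℝ => X (s i) - ∫ x, X x ∂p) ((‖a + 1 - a‖₊ / 2) ^ 2) (samples p m) := by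
    intro i _
    have h := ProbabilityTheory.hasSubgaussianMGF_of_mem_Icc (μ := p) hX.aemeasurable
      (Filter.Eventually.of_forall hb)
    have hmp := measurePreserving_eval (fun _ : Fin m => p) i
    refine ProbabilityTheory.HasSubgaussianMGF.of_map (Y := fun s : Fin m → ℝ => s i)
      (X := fun x => X x - ∫ x, X x ∂p) (measurable_pi_apply i).aemeasurable ?_
    have : (samples p m).map (fun s => s i) = p := hmp.map_eq
    rw [this]
    exact h
  have h := ProbabilityTheory.HasSubgaussianMGF.measure_sum_ge_le_of_iIndepFun hind hsub
    (ε := m * δ) (by positivity)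
  refine h.trans (le_of_eq ?_)
  congr 1
  have : (m : ℝ) ≠ 0 := by positivity
  simp
  field_simp

lemma measureReal_abs_empFreq_sub_ge_le (p : Measure ℝ) [IsProbabilityMeasure p] {m : ℕ}
    (hm : 0 < m) {B : Set ℝ} (hB : MeasurableSet B) {δ : ℝ} (hδ : 0 ≤ δ) :
    (samples p m).real {s | δ ≤ |empFreq s B - p.real B|} ≤
      2 * Real.exp (-(2 * m * δ ^ 2)) := by
  have hm' : (0 : ℝ) < m := by positivity
  have hmeas : Measurable (B.indicator fun _ => (1 : ℝ)) := measurable_const.indicator hB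
  have hint : ∫ x, B.indicator (fun _ => (1 : ℝ)) x ∂p = p.real B := by
    rw [integral_indicator hB]
    simp
  have h1 := measureReal_sum_centered_ge_le p hm hmeas (a := 0) (fun x => by
    by_cases hx : x ∈ B <;> simp [hx]) hδ
  have h2 := measureReal_sum_centered_ge_le p hm hmeas.neg (a := -1) (fun x => by
    by_cases hx : x ∈ B <;> simp [hx]) hδ
  have hsub : {s : Fin m → ℝ | δ ≤ |empFreq s B - p.real B|} ⊆
      {s | m * δ ≤ ∑ i, (B.indicator (fun _ => (1 : ℝ)) (s i) -
        ∫ x, B.indicator (fun _ => (1 : ℝ)) x ∂p)} ∪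
      {s | m * δ ≤ ∑ i, ((-B.indicator fun _ => (1 : ℝ)) (s i) -
        ∫ x, (-B.indicator fun _ => (1 : ℝ)) x ∂p)} := by
    intro s hs
    have hE : ∑ i, B.indicator (fun _ => (1 : ℝ)) (s i) = m * empFreq s B := by
      unfold empFreq
      field_simp
    simp only [mem_union, mem_ofPred_eq, Pi.neg_apply, Finset.sum_sub_distrib, integral_neg, hint,
      Finset.sum_neg_distrib, hE, Finset.sum_const, Finset.card_univ, Fintype.card_fin,
      nsmul_eq_mul] at hs ⊢
    rcases le_abs.1 hs with h | h
    · left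
      nlinarith
    · right
      nlinarith
  calc _ ≤ _ := measureReal_mono hsub
    _ ≤ _ := measureReal_union_le _ _
    _ ≤ _ := by linarith

lemma measureReal_le_of_ordConnected {p : Measure ℝ} [IsProbabilityMeasure p] {κ ρ : ℝ}
    {S : Set ℝ} (hS : S.OrdConnected) (hκ : 0 ≤ κ) (hρ : 0 ≤ ρ) (hat : ∀ x, p.real {x} ≤ κ)
    (hIco : ∀ x ∈ S, ∀ y ∈ S, p.real (Ico x y) ≤ ρ) : p.real S ≤ ρ + κ := by
  have key : p S ≤ ENNReal.ofReal (ρ + κ) := by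
    rw [hS.measurableSet.measure_eq_iSup_isCompact_of_ne_top (measure_ne_top _ _)]
    refine iSup₂_le fun K hKS => iSup_le fun hK => ?_
    rcases K.eq_empty_or_nonempty with rfl | hne
    · simp
    obtain ⟨x, hxK, hx⟩ := hK.exists_isLeast hne
    obtain ⟨y, hyK, hy⟩ := hK.exists_isGreatest hne
    have hxy : x ≤ y := hx hyK
    rw [← ofReal_measureReal]
    refine ENNReal.ofReal_le_ofReal ?_
    calc p.real K ≤ p.real (Ico x y ∪ {y}) := by
          rw [Ico_union_right hxy]
          exact measureReal_mono fun z hz => ⟨hx hz, hy hz⟩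
      _ ≤ p.real (Ico x y) + p.real {y} := measureReal_union_le _ _
      _ ≤ ρ + κ := add_le_add (hIco x (hKS hxK) y (hKS hyK)) (hat y)
  exact ENNReal.toReal_le_of_le_ofReal (by positivity) key

/-- A monotone quantization of the distribution function, all of whose cells have small mass. -/
lemma exists_monotone_quantization (p : Measure ℝ) [IsProbabilityMeasure p] {κ : ℝ} (hκ : 0 < κ)
    (hat : ∀ x, p.real {x} ≤ κ) :
    ∃ J : ℝ → ℕ, Monotone J ∧ (∀ y, 1 ≤ J y ∧ J y ≤ ⌊1 / κ⌋₊ + 1) ∧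
      ∀ n, p.real (J ⁻¹' {n}) ≤ 2 * κ := by
  have hmono : Monotone fun y => ⌊p.real (Iio y) / κ⌋₊ + 1 := by
    intro x y hxy
    have : p.real (Iio x) ≤ p.real (Iio y) := measureReal_mono (Iio_subset_Iio hxy)
    dsimp only
    gcongr
  refine ⟨_, hmono, fun y => ⟨by omega, ?_⟩, fun n => ?_⟩
  · have : p.real (Iio y) ≤ 1 := measureReal_le_one
    gcongr
  · rw [two_mul]
    refine measureReal_le_of_ordConnected (ordConnected_singleton.preimage_mono hmono) hκ.le hκ.le
      hat fun x hx y hy => ?_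
    rcases le_total y x with h | hxy
    · simp [Ico_eq_empty_of_le h, hκ.le]
    simp only [mem_preimage, mem_singleton_iff] at hx hy
    have hfl : ⌊p.real (Iio x) / κ⌋₊ = ⌊p.real (Iio y) / κ⌋₊ := by omega
    have h1 : ⌊p.real (Iio x) / κ⌋₊ ≤ p.real (Iio x) / κ := Nat.floor_le (by positivity)
    have h2 : p.real (Iio y) / κ < ⌊p.real (Iio y) / κ⌋₊ + 1 := Nat.lt_floor_add_one _
    rw [hfl] at h1
    have h3 : p.real (Iio y) / κ < p.real (Iio x) / κ + 1 := by linarith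
    rw [div_add_one hκ.ne', div_lt_div_iff_of_pos_right hκ] at h3
    have h4 : p.real (Iio y) = p.real (Iio x) + p.real (Ico x y) := by
      rw [← Iio_union_Ico_eq_Iio hxy, measureReal_union _ measurableSet_Ico]
      exact Set.disjoint_left.2 fun z hz hz' => absurd hz'.1 (not_le.2 hz)
    linarith

/-- The union over `i` of the preimages under `J` of the integer intervals `(l i, u i)`. -/
def levelUnion {k M : ℕ} (J : ℝ → ℕ) (v : Fin k → Fin M × Fin M) : Set ℝ :=
  ⋃ i, J ⁻¹' Ioo ((v i).1 : ℕ) (v i).2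

lemma measurableSet_levelUnion {k M : ℕ} {J : ℝ → ℕ} (hJ : Monotone J)
    (v : Fin k → Fin M × Fin M) : MeasurableSet (levelUnion J v) :=
  MeasurableSet.iUnion fun _ => (ordConnected_Ioo.preimage_mono hJ).measurableSet

/-- `A` is a union of `k` (possibly empty) intervals. -/
def IsIntervalUnion (k : ℕ) (A : Set ℝ) : Prop :=
  ∃ I : Fin k → Set ℝ, (∀ i, (I i).OrdConnected) ∧ A = ⋃ i, I i

lemma IsIntervalUnion.measurableSet {k : ℕ} {A : Set ℝ} (h : IsIntervalUnion k A) :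
    MeasurableSet A := by
  obtain ⟨I, hI, rfl⟩ := h
  exact MeasurableSet.iUnion fun i => (hI i).measurableSet

lemma exists_level_sandwich {J : ℝ → ℕ} (hJ : Monotone J) {M : ℕ}
    (hJM : ∀ y, 1 ≤ J y ∧ J y + 2 ≤ M) (hM : 0 < M) {p : Measure ℝ} [IsProbabilityMeasure p]
    {η : ℝ} (hη : 0 ≤ η) (hcell : ∀ n, p.real (J ⁻¹' {n}) ≤ η) {I : Set ℝ}
    (hI : I.OrdConnected) :
    ∃ v w : Fin M × Fin M, J ⁻¹' Ioo (v.1 : ℕ) v.2 ⊆ I ∧ I ⊆ J ⁻¹' Ioo (w.1 : ℕ) w.2 ∧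
      p.real (J ⁻¹' Ioo (w.1 : ℕ) w.2 \ J ⁻¹' Ioo (v.1 : ℕ) v.2) ≤ 2 * η := by
  rcases I.eq_empty_or_nonempty with rfl | hne
  · refine ⟨(⟨0, hM⟩, ⟨0, hM⟩), (⟨0, hM⟩, ⟨0, hM⟩), ?_, ?_, ?_⟩ <;> simp [hη]
  obtain ⟨a, ⟨x, hx, rfl⟩, ha⟩ : ∃ a, IsLeast (J '' I) a :=
    ⟨_, Nat.sInf_mem (hne.image J), fun b hb => Nat.sInf_le hb⟩
  have hbdd : BddAbove (J '' I) := ⟨M, by rintro _ ⟨y, _, rfl⟩; have := hJM y; omega⟩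
  obtain ⟨b, ⟨y, hy, rfl⟩, hb⟩ : ∃ b, IsGreatest (J '' I) b :=
    ⟨_, Nat.sSup_mem (hne.image J) hbdd, fun b hb => le_csSup hbdd hb⟩
  have hxM := hJM x
  have hyM := hJM y
  refine ⟨(⟨J x, by omega⟩, ⟨J y, by omega⟩), (⟨J x - 1, by omega⟩, ⟨J y + 1, by omega⟩),
    ?_, ?_, ?_⟩
  · rintro z ⟨hz1, hz2⟩
    exact hI.out hx hy ⟨(hJ.reflect_lt hz1).le, (hJ.reflect_lt hz2).le⟩
  · intro z hz
    have h1 := ha (mem_image_of_mem J hz)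
    have h2 := hb (mem_image_of_mem J hz)
    simp only [mem_preimage, mem_Ioo]
    omega
  · calc _ ≤ p.real (J ⁻¹' {J x} ∪ J ⁻¹' {J y}) := by
          refine measureReal_mono ?_
          rintro z ⟨hz1, hz2⟩
          simp only [mem_preimage, mem_Ioo, mem_union, mem_singleton_iff] at *
          omega
      _ ≤ _ := measureReal_union_le _ _
      _ ≤ 2 * η := by linarith [hcell (J x), hcell (J y)]

lemma IsIntervalUnion.exists_levelUnion_sandwich {J : ℝ → ℕ} (hJ : Monotone J) {M : ℕ}
    (hJM : ∀ y, 1 ≤ J y ∧ J y + 2 ≤ M) (hM : 0 < M) {p : Measure ℝ} [IsProbabilityMeasure p]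
    {η : ℝ} (hη : 0 ≤ η) (hcell : ∀ n, p.real (J ⁻¹' {n}) ≤ η) {k : ℕ} {A : Set ℝ}
    (hA : IsIntervalUnion k A) :
    ∃ v w : Fin k → Fin M × Fin M, levelUnion J v ⊆ A ∧ A ⊆ levelUnion J w ∧
      p.real (levelUnion J w) ≤ p.real (levelUnion J v) + k * (2 * η) := by
  obtain ⟨I, hI, rfl⟩ := hA
  choose v w hv hw hvw using fun i => exists_level_sandwich hJ hJM hM hη hcell (hI i)
  refine ⟨v, w, iUnion_mono hv, iUnion_mono hw, ?_⟩
  calc p.real (levelUnion J w)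
      ≤ p.real (levelUnion J v ∪
          ⋃ i, (J ⁻¹' Ioo ((w i).1 : ℕ) (w i).2 \ J ⁻¹' Ioo ((v i).1 : ℕ) (v i).2)) := by
        refine measureReal_mono fun z hz => ?_
        obtain ⟨i, hi⟩ := mem_iUnion.1 hz
        by_cases h : z ∈ J ⁻¹' Ioo ((v i).1 : ℕ) (v i).2
        · exact Or.inl (mem_iUnion.2 ⟨i, h⟩)
        · exact Or.inr (mem_iUnion.2 ⟨i, hi, h⟩)
    _ ≤ _ := measureReal_union_le _ _
    _ ≤ p.real (levelUnion J v) + ∑ i : Fin k, 2 * η := by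
        gcongr
        exact (measureReal_iUnion_fintype_le _).trans (Finset.sum_le_sum fun i _ => hvw i)
    _ = _ := by simp

/-- Uniform convergence of empirical frequencies over unions of `k` intervals. -/
lemma measureReal_not_uniform_le (p : Measure ℝ) [IsProbabilityMeasure p] {κ : ℝ} (hκ : 0 < κ)
    (hat : ∀ x, p.real {x} ≤ κ) {m : ℕ} (hm : 0 < m) {δ : ℝ} (hδ : 0 ≤ δ) (k : ℕ) :
    (samples p m).real {s | ∀ A, IsIntervalUnion k A →
        |empFreq s A - p.real A| ≤ δ + k * (4 * κ)}ᶜ ≤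
      ((1 / κ + 3) ^ 2) ^ k * (2 * Real.exp (-(2 * m * δ ^ 2))) := by
  obtain ⟨J, hJ, hJM, hcell⟩ := exists_monotone_quantization p hκ hat
  set M := ⌊1 / κ⌋₊ + 3 with hMdef
  have hJM' : ∀ y, 1 ≤ J y ∧ J y + 2 ≤ M := fun y => ⟨(hJM y).1, by have := (hJM y).2; omega⟩
  have hM : 0 < M := by omega
  have hMle : (M : ℝ) ≤ 1 / κ + 3 := by
    rw [hMdef]
    push_cast
    gcongr
    exact Nat.floor_le (by positivity)
  have hsub : {s : Fin m → ℝ | ∀ A, IsIntervalUnion k A →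
        |empFreq s A - p.real A| ≤ δ + k * (4 * κ)}ᶜ ⊆
      ⋃ v : Fin k → Fin M × Fin M,
        {s | δ ≤ |empFreq s (levelUnion J v) - p.real (levelUnion J v)|} := by
    intro s
    contrapose!
    intro hs
    simp only [mem_iUnion, mem_ofPred_eq, not_exists, not_le, notMem_compl_iff] at hs ⊢
    intro A hA
    obtain ⟨v, w, hvA, hAw, hvw⟩ :=
      hA.exists_levelUnion_sandwich hJ hJM' hM (by positivity) hcell
    have h1 := abs_lt.1 (hs v)
    have h2 := abs_lt.1 (hs w)
    have h3 := empFreq_mono s hvA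
    have h4 := empFreq_mono s hAw
    have h5 : p.real (levelUnion J v) ≤ p.real A := measureReal_mono hvA
    have h6 : p.real A ≤ p.real (levelUnion J w) := measureReal_mono hAw
    rw [abs_le]
    constructor <;> linarith
  calc _ ≤ _ := measureReal_mono hsub
    _ ≤ ∑ v : Fin k → Fin M × Fin M, 2 * Real.exp (-(2 * m * δ ^ 2)) :=
        (measureReal_iUnion_fintype_le _).trans (Finset.sum_le_sum fun v _ =>
          measureReal_abs_empFreq_sub_ge_le p hm (measurableSet_levelUnion hJ v) hδ)
    _ = ((M : ℝ) ^ 2) ^ k * (2 * Real.exp (-(2 * m * δ ^ 2))) := by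
        simp [sq]
    _ ≤ _ := by gcongr

lemma isIntervalUnion_iUnion {ι : Type*} [Fintype ι] {k : ℕ} (hk : Fintype.card ι = k)
    {I : ι → Set ℝ} (hI : ∀ i, (I i).OrdConnected) : IsIntervalUnion k (⋃ i, I i) :=
  let e := Fintype.equivFinOfCardEq hk
  ⟨fun j => I (e.symm j), fun _ => hI _, (e.symm.surjective.iUnion_comp I).symm⟩

lemma exists_mem_Ico_castSucc_succ {t : ℕ} {x : Fin (t + 1) → ℝ} {y : ℝ}
    (hy : y ∈ Ico (x 0) (x (Fin.last t))) : ∃ i : Fin t, y ∈ Ico (x i.castSucc) (x i.succ) := by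
  by_contra! h
  have : ∀ i, x i ≤ y := by
    intro i
    induction i using Fin.induction with
    | zero => exact hy.1
    | succ i ih => exact not_lt.1 fun h' => h i ⟨ih, h'⟩
  exact absurd (this (Fin.last t)) (not_le.2 hy.2)

lemma monotone_card_filter_le (S : Finset ℝ) : Monotone fun z => (S.filter (· ≤ z)).card :=
  fun _ _ h => Finset.card_le_card fun _ hs => by
    simp only [Finset.mem_filter] at hs ⊢
    exact ⟨hs.1, hs.2.trans h⟩

lemma monotone_card_filter_lt (S : Finset ℝ) : Monotone fun z => (S.filter (· < z)).card :=
  fun _ _ h => Finset.card_le_card fun _ hs => by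
    simp only [Finset.mem_filter] at hs ⊢
    exact ⟨hs.1, hs.2.trans_le h⟩

lemma le_iff_le_of_card_filter_eq {S : Finset ℝ} {y z : ℝ}
    (h : (S.filter (· ≤ y)).card = (S.filter (· ≤ z)).card) {s : ℝ} (hs : s ∈ S) :
    s ≤ y ↔ s ≤ z := by
  have key : ∀ {y z : ℝ}, y ≤ z → (S.filter (· ≤ y)).card = (S.filter (· ≤ z)).card →
      (s ≤ y ↔ s ≤ z) := by
    intro y z hyz h
    have hsub : S.filter (· ≤ y) ⊆ S.filter (· ≤ z) := fun u hu => by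
      simp only [Finset.mem_filter] at hu ⊢
      exact ⟨hu.1, hu.2.trans hyz⟩
    have := congrArg (s ∈ ·) (Finset.eq_of_subset_of_card_le hsub h.ge)
    simpa [hs] using this
  rcases le_total y z with hyz | hzy
  · exact key hyz h
  · exact (key hzy h.symm).symm

lemma exists_polynomial_of_card_filter_eq {a b : ℝ} {t d : ℕ} {f : ℝ → ℝ} {x : Fin (t + 1) → ℝ}
    (h0 : x 0 = a) (h1 : x (Fin.last t) = b)
    (hf : ∀ i : Fin t, ∃ P : Polynomial ℝ, P.natDegree ≤ d ∧
      ∀ y ∈ Ico (x i.castSucc) (x i.succ), f y = P.eval y)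
    {S : Finset ℝ} (hS : ∀ i, x i ∈ S) (n : ℕ) :
    ∃ P : Polynomial ℝ, P.natDegree ≤ d ∧
      ∀ z ∈ Ico a b, (S.filter (· ≤ z)).card = n → f z = P.eval z := by
  subst h0 h1
  by_cases hex : ∃ y ∈ Ico (x 0) (x (Fin.last t)), (S.filter (· ≤ y)).card = n
  · obtain ⟨y, hy, rfl⟩ := hex
    obtain ⟨i, hi⟩ := exists_mem_Ico_castSucc_succ hy
    obtain ⟨P, hPd, hP⟩ := hf i
    refine ⟨P, hPd, fun z _ hz => hP z ⟨?_, ?_⟩⟩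
    · exact (le_iff_le_of_card_filter_eq hz (hS _)).2 hi.1
    · exact not_le.1 fun h => absurd ((le_iff_le_of_card_filter_eq hz (hS _)).1 h) (not_le.2 hi.2)
  · push Not at hex
    exact ⟨0, by simp, fun z hz hzn => absurd hzn (hex z hz)⟩

lemma ordConnected_setOf_eval_pos (D : Polynomial ℝ) (l : ℕ) :
    OrdConnected {z | 0 < D.eval z ∧ (D.roots.toFinset.filter (· < z)).card = l} := by
  refine ⟨?_⟩
  rintro y ⟨hy, hyl⟩ z ⟨hz, hzl⟩ w hw
  have hw1 := monotone_card_filter_lt D.roots.toFinset hw.1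
  have hw2 := monotone_card_filter_lt D.roots.toFinset hw.2
  dsimp only at hw1 hw2
  refine ⟨?_, by omega⟩
  by_contra! hneg
  have hD : D ≠ 0 := by
    rintro rfl
    simp at hy
  obtain ⟨r, ⟨hr1, hr2⟩, hr⟩ : (0 : ℝ) ∈ (fun u => D.eval u) '' Icc y w :=
    intermediate_value_Icc' hw.1 D.continuous.continuousOn ⟨hneg, hy.le⟩
  have hrz : r < z := by
    refine (hr2.trans hw.2).lt_of_ne ?_
    rintro rfl
    exact hz.ne' hr
  have hlt : (D.roots.toFinset.filter (· < y)).card < (D.roots.toFinset.filter (· < z)).card := by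
    refine Finset.card_lt_card (Finset.ssubset_iff_of_subset (fun u hu => ?_) |>.2 ⟨r, ?_, ?_⟩)
    · simp only [Finset.mem_filter] at hu ⊢
      exact ⟨hu.1, hu.2.trans_le (hw.1.trans hw.2)⟩
    · simp only [Finset.mem_filter, Multiset.mem_toFinset, Polynomial.mem_roots hD]
      exact ⟨hr, hrz⟩
    · simp only [Finset.mem_filter, not_and, not_lt]
      exact fun _ => hr1
  omega

/-- The set where one piecewise polynomial exceeds another has few connected components. -/
lemma IsPiecewisePoly.isIntervalUnion_lt {a b : ℝ} {t d : ℕ} {f g : ℝ → ℝ}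
    (hf : IsPiecewisePoly a b t d f) (hg : IsPiecewisePoly a b t d g) :
    IsIntervalUnion ((2 * t + 3) * (d + 1)) {z | z ∈ Ico a b ∧ g z < f z} := by
  obtain ⟨x, hx0, hx1, -, hx⟩ := hf
  obtain ⟨y, hy0, hy1, -, hy⟩ := hg
  set S : Finset ℝ := Finset.univ.image x ∪ Finset.univ.image y with hS
  have hScard : S.card ≤ 2 * t + 2 := by
    have h1 := Finset.card_union_le (Finset.univ.image x) (Finset.univ.image y)
    have h2 : (Finset.univ.image x).card ≤ _ := Finset.card_image_le
    have h3 : (Finset.univ.image y).card ≤ _ := Finset.card_image_le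
    simp only [Finset.card_univ, Fintype.card_fin] at h2 h3
    rw [hS]
    omega
  choose P hPd hP using exists_polynomial_of_card_filter_eq hx0 hx1 hx (S := S) (by simp [hS])
  choose Q hQd hQ using exists_polynomial_of_card_filter_eq hy0 hy1 hy (S := S) (by simp [hS])
  have hcard : Fintype.card (Fin (2 * t + 3) × Fin (d + 1)) = (2 * t + 3) * (d + 1) := by simp
  have hI : ∀ i : Fin (2 * t + 3) × Fin (d + 1), OrdConnected
      ((Ico a b ∩ (fun z => (S.filter (· ≤ z)).card) ⁻¹' {(i.1 : ℕ)}) ∩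
        {z | 0 < (P i.1 - Q i.1).eval z ∧
          ((P i.1 - Q i.1).roots.toFinset.filter (· < z)).card = i.2}) := fun i =>
    (ordConnected_Ico.inter (ordConnected_singleton.preimage_mono
      (monotone_card_filter_le S))).inter (ordConnected_setOf_eval_pos _ _)
  convert isIntervalUnion_iUnion hcard hI using 1
  ext z
  simp only [mem_ofPred_eq, mem_iUnion, mem_inter_iff, mem_preimage, mem_singleton_iff,
    Prod.exists, Polynomial.eval_sub, sub_pos]
  constructor
  · rintro ⟨hz, hlt⟩
    set n := (S.filter (· ≤ z)).card with hn
    have hnle : n ≤ 2 * t + 2 := (Finset.card_filter_le _ _).trans hScard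
    have hdeg : (P n - Q n).natDegree ≤ d := Polynomial.natDegree_sub_le_of_le (hPd n) (hQd n)
      |>.trans (max_self d).le
    have hl : ((P n - Q n).roots.toFinset.filter (· < z)).card ≤ d :=
      (Finset.card_filter_le _ _).trans ((Multiset.toFinset_card_le _).trans
        ((Polynomial.card_roots' _).trans hdeg))
    refine ⟨⟨n, by omega⟩, ⟨_, Nat.lt_succ_of_le hl⟩, ⟨hz, hn.symm⟩, ?_, rfl⟩
    rw [← hP n z hz hn.symm, ← hQ n z hz hn.symm]
    exact hlt
  · rintro ⟨n, l, ⟨hz, hn⟩, hlt, -⟩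
    refine ⟨hz, ?_⟩
    rw [hP n z hz hn, hQ n z hz hn]
    exact hlt

lemma measureReal_sub_le_of_density {μ q₁ q₂ : Measure ℝ} [IsProbabilityMeasure q₁]
    [IsProbabilityMeasure q₂] {f₁ f₂ : ℝ → ℝ} {I : Set ℝ} (hI : MeasurableSet I)
    (h₁ : q₁ = (μ.restrict I).withDensity fun y => ENNReal.ofReal (f₁ y))
    (h₂ : q₂ = (μ.restrict I).withDensity fun y => ENNReal.ofReal (f₂ y))
    (hA : MeasurableSet {z | z ∈ I ∧ f₂ z < f₁ z}) {B : Set ℝ} (hB : MeasurableSet B) :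
    q₁.real B - q₂.real B ≤
      q₁.real {z | z ∈ I ∧ f₂ z < f₁ z} - q₂.real {z | z ∈ I ∧ f₂ z < f₁ z} := by
  set A := {z | z ∈ I ∧ f₂ z < f₁ z} with hAdef
  have hmono : ∀ {q q' : Measure ℝ} [IsProbabilityMeasure q'] {f f' : ℝ → ℝ},
      q = (μ.restrict I).withDensity (fun y => ENNReal.ofReal (f y)) →
      q' = (μ.restrict I).withDensity (fun y => ENNReal.ofReal (f' y)) →
      ∀ {D : Set ℝ}, MeasurableSet D → (∀ z ∈ D ∩ I, f z ≤ f' z) → q.real D ≤ q'.real D := by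
    intro q q' _ f f' hq hq' D hD hle
    refine ENNReal.toReal_mono (measure_ne_top q' D) ?_
    rw [hq, hq', withDensity_apply _ hD, withDensity_apply _ hD, Measure.restrict_restrict hD]
    exact setLIntegral_mono' (hD.inter hI) fun z hz => ENNReal.ofReal_le_ofReal (hle z hz)
  have e1 : q₁.real (B \ A) ≤ q₂.real (B \ A) := by
    refine hmono h₁ h₂ (hB.diff hA) fun z hz => not_lt.1 fun h => hz.1.2 ⟨hz.2, h⟩
  have e2 : q₂.real (A \ B) ≤ q₁.real (A \ B) := by
    refine hmono h₂ h₁ (hA.diff hB) fun z hz => hz.1.1.2.le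
  have a1 := measureReal_inter_add_sdiff (μ := q₁) (s := B) hA
  have a2 := measureReal_inter_add_sdiff (μ := q₂) (s := B) hA
  have a3 := measureReal_inter_add_sdiff (μ := q₁) (s := A) hB
  have a4 := measureReal_inter_add_sdiff (μ := q₂) (s := A) hB
  rw [inter_comm A B] at a3 a4
  linarith

/-- The total variation distance of two piecewise polynomial distributions is attained on a union
of few intervals. -/
lemma tvDist_le_of_isIntervalUnion {a b : ℝ} {t d : ℕ} {f₁ f₂ : ℝ → ℝ} {q₁ q₂ : Measure ℝ}
    [IsProbabilityMeasure q₁] [IsProbabilityMeasure q₂]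
    (h₁ : q₁ = (volume.restrict (Ico a b)).withDensity fun y => ENNReal.ofReal (f₁ y))
    (h₂ : q₂ = (volume.restrict (Ico a b)).withDensity fun y => ENNReal.ofReal (f₂ y))
    (hf₁ : IsPiecewisePoly a b t d f₁) (hf₂ : IsPiecewisePoly a b t d f₂) {c : ℝ}
    (h12 : |q₁.real {z | z ∈ Ico a b ∧ f₂ z < f₁ z} -
      q₂.real {z | z ∈ Ico a b ∧ f₂ z < f₁ z}| ≤ c)
    (h21 : |q₁.real {z | z ∈ Ico a b ∧ f₁ z < f₂ z} -
      q₂.real {z | z ∈ Ico a b ∧ f₁ z < f₂ z}| ≤ c) :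
    tvDist q₁ q₂ ≤ c := by
  refine tvDist_le fun B hB => ?_
  have e1 := measureReal_sub_le_of_density measurableSet_Ico h₁ h₂
    (hf₁.isIntervalUnion_lt hf₂).measurableSet hB
  have e2 := measureReal_sub_le_of_density measurableSet_Ico h₂ h₁
    (hf₂.isIntervalUnion_lt hf₁).measurableSet hB
  rw [abs_le] at *
  constructor <;> linarith

lemma IsPiecewisePoly.aemeasurable {a b : ℝ} {t d : ℕ} {f : ℝ → ℝ}
    (hf : IsPiecewisePoly a b t d f) : AEMeasurable f (volume.restrict (Ico a b)) := by
  obtain ⟨x, rfl, rfl, -, hx⟩ := hf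
  have : AEMeasurable f (volume.restrict (⋃ i : Fin t, Ico (x i.castSucc) (x i.succ))) := by
    refine AEMeasurable.iUnion fun i => ?_
    obtain ⟨P, -, hP⟩ := hx i
    refine P.continuous.measurable.aemeasurable.congr ?_
    filter_upwards [ae_restrict_mem measurableSet_Ico] with y hy using (hP y hy).symm
  refine this.mono_set fun y hy => ?_
  obtain ⟨i, hi⟩ := exists_mem_Ico_castSucc_succ hy
  exact mem_iUnion.2 ⟨i, hi⟩

lemma IsPiecewisePoly.integrable {a b : ℝ} {t d : ℕ} {f : ℝ → ℝ} {q : Measure ℝ}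
    [IsProbabilityMeasure q] (hf0 : ∀ y ∈ Ico a b, 0 ≤ f y)
    (hq : q = (volume.restrict (Ico a b)).withDensity fun y => ENNReal.ofReal (f y))
    (hf : IsPiecewisePoly a b t d f) : Integrable f (volume.restrict (Ico a b)) := by
  refine ⟨hf.aemeasurable.aestronglyMeasurable, ?_⟩
  rw [hasFiniteIntegral_iff_ofReal]
  · have h : q univ = 1 := measure_univ
    rw [hq, withDensity_apply _ MeasurableSet.univ, Measure.restrict_univ] at h
    rw [h]
    exact ENNReal.one_lt_top
  · filter_upwards [ae_restrict_mem measurableSet_Ico] with y hy using hf0 y hy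

lemma measureReal_eq_setIntegral {μ q : Measure ℝ} {f : ℝ → ℝ}
    (hf0 : 0 ≤ᵐ[μ] f) (hf : Integrable f μ)
    (hq : q = μ.withDensity fun y => ENNReal.ofReal (f y)) {B : Set ℝ} (hB : MeasurableSet B) :
    q.real B = ∫ y in B, f y ∂μ := by
  rw [measureReal_def, hq, withDensity_apply _ hB,
    integral_eq_lintegral_of_nonneg_ae (ae_restrict_of_ae hf0) hf.aestronglyMeasurable.restrict]

lemma tvDist_le_dist_toL1 {μ q₁ q₂ : Measure ℝ} {f₁ f₂ : ℝ → ℝ} (h₁0 : 0 ≤ᵐ[μ] f₁)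
    (h₂0 : 0 ≤ᵐ[μ] f₂) (hf₁ : Integrable f₁ μ) (hf₂ : Integrable f₂ μ)
    (h₁ : q₁ = μ.withDensity fun y => ENNReal.ofReal (f₁ y))
    (h₂ : q₂ = μ.withDensity fun y => ENNReal.ofReal (f₂ y)) :
    tvDist q₁ q₂ ≤ dist (hf₁.toL1 f₁) (hf₂.toL1 f₂) := by
  refine tvDist_le fun B hB => ?_
  rw [measureReal_eq_setIntegral h₁0 hf₁ h₁ hB, measureReal_eq_setIntegral h₂0 hf₂ h₂ hB,
    ← integral_sub hf₁.integrableOn hf₂.integrableOn, dist_eq_norm, ← Integrable.toL1_sub,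
    L1.norm_of_fun_eq_integral_norm, ← Real.norm_eq_abs]
  exact (norm_integral_le_integral_norm _).trans
    (setIntegral_le_integral (hf₁.sub hf₂).norm (Filter.Eventually.of_forall fun _ => norm_nonneg _))

/-- Piecewise polynomial distributions have a countable dense sequence in total variation. -/
lemma exists_dense_seq_isPiecewisePolyDist {a b : ℝ} {t d : ℕ}
    (hne : ∃ q, IsPiecewisePolyDist q a b t d) :
    ∃ h : ℕ → Measure ℝ, (∀ n, IsPiecewisePolyDist (h n) a b t d) ∧
      ∀ q, IsPiecewisePolyDist q a b t d → ∀ ε > 0, ∃ n, tvDist q (h n) < ε := by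
  let μ := volume.restrict (Ico a b)
  let Q := {q : Measure ℝ // IsPiecewisePolyDist q a b t d}
  have : Nonempty Q := let ⟨q, hq⟩ := hne; ⟨⟨q, hq⟩⟩
  have hdata : ∀ q : Q, ∃ f : ℝ → ℝ, 0 ≤ᵐ[μ] f ∧ Integrable f μ ∧
      q.1 = μ.withDensity fun y => ENNReal.ofReal (f y) := by
    rintro ⟨q, hq, f, hf0, hqf, hf⟩
    refine ⟨f, ?_, hf.integrable hf0 hqf, hqf⟩
    filter_upwards [ae_restrict_mem measurableSet_Ico] with y hy using hf0 y hy
  choose f hf0 hfi hqf using hdata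
  let F : Q → (ℝ →₁[μ] ℝ) := fun q => (hfi q).toL1 (f q)
  have : Fact ((1 : ℝ≥0∞) ≤ 1) := ⟨le_rfl⟩
  have : Fact ((1 : ℝ≥0∞) ≠ ⊤) := ⟨ENNReal.one_ne_top⟩
  let u : ℕ → range F := TopologicalSpace.denseSeq (range F)
  have hu : DenseRange u := TopologicalSpace.denseRange_denseSeq _
  choose r hr using fun n => (u n).2
  refine ⟨fun n => (r n).1, fun n => (r n).2, fun q hq ε hε => ?_⟩
  obtain ⟨n, hn⟩ := hu.exists_dist_lt ⟨F ⟨q, hq⟩, mem_range_self _⟩ hε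
  refine ⟨n, (tvDist_le_dist_toL1 (hf0 ⟨q, hq⟩) (hf0 (r n)) (hfi ⟨q, hq⟩) (hfi (r n))
    (hqf ⟨q, hq⟩) (hqf (r n))).trans_lt ?_⟩
  rw [Subtype.dist_eq, ← hr n] at hn
  exact hn

lemma IsPiecewisePolyDist.mono_pieces {q : Measure ℝ} {a b : ℝ} {t n d : ℕ} (htn : t ≤ n)
    (h : IsPiecewisePolyDist q a b t d) : IsPiecewisePolyDist q a b n d := by
  obtain ⟨hq, f, hf0, hqf, x, hx0, hx1, hx, hP⟩ := h
  refine ⟨hq, f, hf0, hqf, fun i => x ⟨min i t, by omega⟩, ?_, ?_, ?_, fun i => ?_⟩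
  · simpa using hx0
  · refine (congrArg x (Fin.ext ?_)).trans hx1
    simp [htn]
  · intro i j hij
    refine hx ?_
    simp only [Fin.mk_le_mk]
    have : (i : ℕ) ≤ j := hij
    omega
  · by_cases hi : (i : ℕ) < t
    · obtain ⟨P, hPd, hP⟩ := hP ⟨i, hi⟩
      refine ⟨P, hPd, fun y hy => hP y ?_⟩
      convert hy using 3
      · ext
        simp
        omega
      · ext
        simp
        omega
    · refine ⟨0, by simp, fun y hy => ?_⟩
      have h1 : min (i : ℕ) t = t := by omega
      have h2 : min ((i : ℕ) + 1) t = t := by omega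
      simp [h1, h2] at hy

lemma exists_isPiecewisePolyDist {t d : ℕ} (ht : 1 ≤ t) :
    ∃ q, IsPiecewisePolyDist q (-1) 1 t d := by
  refine ⟨(volume.restrict (Ico (-1) 1)).withDensity fun _ => ENNReal.ofReal (1 / 2),
    IsPiecewisePolyDist.mono_pieces ht ⟨⟨?_⟩, fun _ => 1 / 2, fun _ _ => by norm_num, rfl,
      ![-1, 1], rfl, rfl, ?_, fun i => ⟨Polynomial.C (1 / 2), by simp, by simp⟩⟩⟩
  · rw [withDensity_const, Measure.smul_apply, Measure.restrict_apply_univ, Real.volume_Ico,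
      smul_eq_mul, ← ENNReal.ofReal_mul (by norm_num)]
    norm_num
  · intro i j hij
    fin_cases i <;> fin_cases j <;> simp_all

lemma empFreq_mem_Icc {m : ℕ} (s : Fin m → ℝ) (B : Set ℝ) : empFreq s B ∈ Icc (0 : ℝ) 1 := by
  unfold empFreq
  have h0 : ∀ x, 0 ≤ B.indicator (fun _ => (1 : ℝ)) x :=
    indicator_nonneg fun _ _ => zero_le_one
  refine ⟨div_nonneg (Finset.sum_nonneg fun i _ => h0 _) (Nat.cast_nonneg m),
    div_le_one_of_le₀ ?_ (Nat.cast_nonneg m)⟩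
  calc ∑ i, B.indicator (fun _ => (1 : ℝ)) (s i) ≤ ∑ _i : Fin m, (1 : ℝ) :=
        Finset.sum_le_sum fun i _ => indicator_le_self' (fun _ _ => zero_le_one) _
    _ = m := by simp

lemma abs_measureReal_sub_empFreq_le_one (q : Measure ℝ) [IsProbabilityMeasure q] {m : ℕ}
    (s : Fin m → ℝ) (B : Set ℝ) : |q.real B - empFreq s B| ≤ 1 := by
  have h1 : q.real B ≤ 1 := measureReal_le_one
  have h2 : 0 ≤ q.real B := measureReal_nonneg
  have h3 := empFreq_mem_Icc s B
  rw [abs_le]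
  constructor <;> linarith [h3.1, h3.2]

/-- The minimum distance estimator over the Yatracos class. -/
lemma exists_minimum_distance_estimator {t d : ℕ} (ht : 1 ≤ t) {ε : ℝ} (hε : 0 < ε) (m : ℕ) :
    ∃ A : (Fin m → ℝ) → Measure ℝ, Measurable A ∧
      (∀ s, IsPiecewisePolyDist (A s) (-1) 1 t d) ∧
      ∀ (p : Measure ℝ) [IsProbabilityMeasure p] (s : Fin m → ℝ) (Δ : ℝ),
        (∀ S, IsIntervalUnion ((2 * t + 3) * (d + 1)) S → |empFreq s S - p.real S| ≤ Δ) →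
        tvDist p (A s) ≤ 3 * optTD p t d + 2 * Δ + 7 * ε := by
  classical
  obtain ⟨h, hh, hdense⟩ := exists_dense_seq_isPiecewisePolyDist
    (exists_isPiecewisePolyDist (d := d) ht)
  have hprob : ∀ n, IsProbabilityMeasure (h n) := fun n => (hh n).1
  choose f _ hhf hf using fun n => (hh n).2
  let S : ℕ × ℕ → Set ℝ := fun i => {z | z ∈ Ico (-1) 1 ∧ f i.2 z < f i.1 z}
  have hS : ∀ i, IsIntervalUnion ((2 * t + 3) * (d + 1)) (S i) := fun i =>
    (hf i.1).isIntervalUnion_lt (hf i.2)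
  let discr : (Fin m → ℝ) → ℕ → ℝ := fun s n => ⨆ i, |(h n).real (S i) - empFreq s (S i)|
  have hle : ∀ s n i, |(h n).real (S i) - empFreq s (S i)| ≤ discr s n := fun s n i =>
    le_ciSup (f := fun i => |(h n).real (S i) - empFreq s (S i)|)
      ⟨1, by rintro _ ⟨j, rfl⟩; exact abs_measureReal_sub_empFreq_le_one _ _ _⟩ i
  have hmeas : ∀ n, Measurable fun s => discr s n := fun n =>
    Measurable.iSup fun i => measurable_norm.comp
      ((measurable_empFreq (hS i).measurableSet).const_sub _)
  have hex : ∀ s, ∃ n, ∀ k, discr s n ≤ discr s k + ε := by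
    intro s
    have hbdd : BddBelow (range (discr s)) :=
      ⟨0, by rintro _ ⟨n, rfl⟩; exact (abs_nonneg _).trans (hle s n (0, 0))⟩
    obtain ⟨n, hn⟩ := exists_lt_of_ciInf_lt (lt_add_of_pos_right (⨅ n, discr s n) hε)
    exact ⟨n, fun k => hn.le.trans (by gcongr; exact ciInf_le hbdd k)⟩
  have hNmeas : Measurable fun s => Nat.find (hex s) := by
    refine measurable_find hex fun n => ?_
    simp only [ofPred_forall]
    exact MeasurableSet.iInter fun k => measurableSet_le (hmeas n) ((hmeas k).add_const ε)
  refine ⟨fun s => h (Nat.find (hex s)), (measurable_from_nat (f := h)).comp hNmeas,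
    fun s => hh _, fun p _ s Δ hΔ => ?_⟩
  set N := Nat.find (hex s)
  have hN : ∀ k, discr s N ≤ discr s k + ε := Nat.find_spec (hex s)
  obtain ⟨_, ⟨q, hq, rfl⟩, hpq⟩ := exists_lt_of_csInf_lt
    (s := {x : ℝ | ∃ q : Measure ℝ, IsPiecewisePolyDist q (-1) 1 t d ∧ x = tvDist p q})
    (let ⟨q, hq⟩ := exists_isPiecewisePolyDist (d := d) ht; ⟨_, q, hq, rfl⟩)
    (lt_add_of_pos_right (optTD p t d) hε)
  obtain ⟨n, hn⟩ := hdense q hq ε hε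
  have := hq.1
  have hpn : tvDist p (h n) ≤ optTD p t d + 2 * ε := by
    linarith [tvDist_triangle p q (h n)]
  have hdn : discr s n ≤ tvDist p (h n) + Δ := by
    refine ciSup_le fun i => ?_
    have h1 := abs_measureReal_sub_le_tvDist p (h n) (hS i).measurableSet
    have h2 := hΔ _ (hS i)
    rw [abs_le] at *
    constructor <;> linarith
  have key : ∀ i, |(h n).real (S i) - (h N).real (S i)| ≤
      2 * optTD p t d + 5 * ε + 2 * Δ := by
    intro i
    have h1 := hle s n i
    have h2 := hle s N i
    have h3 := hN n
    rw [abs_le] at *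
    constructor <;> linarith
  have htv : tvDist (h n) (h N) ≤ 2 * optTD p t d + 5 * ε + 2 * Δ :=
    tvDist_le_of_isIntervalUnion (hhf n) (hhf N) (hf n) (hf N) (key (n, N)) (key (N, n))
  linarith [tvDist_triangle p (h n) (h N)]

lemma optTD_nonneg (p : Measure ℝ) [IsProbabilityMeasure p] (t d : ℕ) : 0 ≤ optTD p t d := by
  refine Real.sInf_nonneg ?_
  rintro _ ⟨q, hq, rfl⟩
  have := hq.1
  exact tvDist_nonneg p q

lemma union_bound_le_one_tenth {K ε x k : ℝ} {m j : ℕ} (hK : 1 ≤ K) (hε : 0 < ε)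
    (hR : 100 ≤ K / ε) (hj : (j : ℝ) = k) (hk : k ≤ 5 * K) (hx0 : 0 ≤ x) (hx : x ≤ 67 * (K / ε))
    (hm : 11 * K * Real.log (K / ε) / ε ^ 2 ≤ m) :
    (x ^ 2) ^ j * (2 * Real.exp (-(2 * m * ε ^ 2))) ≤ 1 / 10 := by
  set R := K / ε
  set L := Real.log R
  have hR0 : 0 < R := by linarith
  have hL : 0 ≤ L := Real.log_nonneg (by linarith)
  have hexp : Real.exp L = R := Real.exp_log hR0
  have hx2 : x ^ 2 ≤ Real.exp (4 * L) := by
    have h1 : x ≤ R ^ 2 := by nlinarith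
    calc x ^ 2 ≤ (R ^ 2) ^ 2 := by gcongr
      _ = Real.exp (4 * L) := by
        rw [← hexp, ← pow_mul, ← Real.exp_nat_mul]
        norm_num
  have hm' : 11 * K * L ≤ m * ε ^ 2 := (div_le_iff₀ (by positivity)).1 hm
  have hkL : k * L ≤ 5 * K * L := by gcongr
  have hKL : L ≤ K * L := by nlinarith
  calc (x ^ 2) ^ j * (2 * Real.exp (-(2 * m * ε ^ 2)))
      ≤ Real.exp (4 * L) ^ j * (2 * Real.exp (-(22 * K * L))) := by
        gcongr ?_ ^ j * (2 * Real.exp ?_)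
        linarith
    _ = 2 * Real.exp (4 * (k * L) - 22 * K * L) := by
        rw [← Real.exp_nat_mul, hj, mul_left_comm, ← Real.exp_add]
        ring_nf
    _ ≤ 2 * Real.exp (-L) := by
        gcongr
        linarith
    _ = 2 / R := by
        rw [Real.exp_neg, hexp, div_eq_mul_inv]
    _ ≤ 1 / 10 := by
        rw [div_le_div_iff₀ hR0 (by norm_num)]
        linarith

/-- Theorem thm:piece-poly: semi-agnostically learning t-piecewise degree-d
densities from a well-behaved distribution over [-1,1). -/
theorem learn_piecewise_polynomial_wb :
    ∃ C c : ℝ, 0 < C ∧ 0 < c ∧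
      ∀ t d : ℕ, 1 ≤ t → ∀ ε : ℝ, 0 < ε → ε < 1 →
        ∃ (m : ℕ) (A : (Fin m → ℝ) → Measure ℝ),
          (m : ℝ) ≤ C * (t : ℝ) * ((d : ℝ) + 1) *
              (Real.log ((t : ℝ) * ((d : ℝ) + 1) / ε)) ^ c / ε ^ 2 ∧
          Measurable A ∧
          ∀ p : Measure ℝ, IsProbabilityMeasure p → p (Set.Ico (-1 : ℝ) 1) = 1 →
            (∀ x : ℝ, p {x} ≤ ENNReal.ofReal (ε / (64 * (t : ℝ) * ((d : ℝ) + 1)))) →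
            (9 / 10 : ℝ≥0∞) ≤ samples p m
              {s | IsPiecewisePolyDist (A s) (-1) 1 (2 * t - 1) d ∧
                   tvDist p (A s) ≤ 3 * optTD p t d * (1 + ε) + C * ε} := by

  refine ⟨100, 1, by norm_num, one_pos, fun t d ht ε hε hε1 => ?_⟩
  have ht' : (1 : ℝ) ≤ t := by exact_mod_cast ht
  set K : ℝ := (t : ℝ) * ((d : ℝ) + 1) with hKdef
  have hK : 1 ≤ K := by
    have : (0 : ℝ) ≤ d := Nat.cast_nonneg d
    nlinarith
  have hle : t ≤ 2 * t - 1 := by omega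
  rw [Real.rpow_one, mul_assoc (100 : ℝ), ← hKdef]
  rcases lt_or_ge (1 / 100) ε with hbig | hsmall
  · have hlog : 0 ≤ Real.log (K / ε) :=
      Real.log_nonneg ((one_le_div hε).2 (by linarith))
    obtain ⟨q, hq⟩ := exists_isPiecewisePolyDist (d := d) ht
    refine ⟨0, fun _ => q, by rw [Nat.cast_zero]; positivity, measurable_const,
      fun p hp _ _ => ?_⟩
    have := hq.1
    have hall : {s : Fin 0 → ℝ | IsPiecewisePolyDist q (-1) 1 (2 * t - 1) d ∧
        tvDist p q ≤ 3 * optTD p t d * (1 + ε) + 100 * ε} = univ := by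
      refine eq_univ_of_forall fun _ => ⟨hq.mono_pieces hle, ?_⟩
      have h1 := optTD_nonneg p t d
      have h2 := tvDist_le_one p q
      have h3 : 0 ≤ 3 * optTD p t d * (1 + ε) := by positivity
      linarith
    rw [hall, measure_univ]
    exact ENNReal.div_le_of_le_mul (by norm_num)
  have hR : 100 ≤ K / ε := by
    rw [le_div_iff₀ hε]
    linarith
  have hlog : 1 ≤ Real.log (K / ε) := by
    rw [Real.le_log_iff_exp_le (by linarith)]
    linarith [Real.exp_one_lt_d9]
  set m := ⌈11 * K * Real.log (K / ε) / ε ^ 2⌉₊ with hmdef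
  have hmle : 11 * K * Real.log (K / ε) / ε ^ 2 ≤ m := Nat.le_ceil _
  have hm0 : 0 < m := Nat.ceil_pos.2 (by positivity)
  obtain ⟨A, hAmeas, hA, hAtv⟩ := exists_minimum_distance_estimator (d := d) ht hε m
  refine ⟨m, A, ?_, hAmeas, fun p hp _ hat => ?_⟩
  · have h1 := Nat.ceil_lt_add_one (a := 11 * K * Real.log (K / ε) / ε ^ 2) (by positivity)
    have h2 : 1 ≤ K * Real.log (K / ε) / ε ^ 2 := by
      rw [one_le_div (by positivity)]
      nlinarith
    have h3 : 11 * K * Real.log (K / ε) / ε ^ 2 = 11 * (K * Real.log (K / ε) / ε ^ 2) := by ring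
    have h4 : 100 * K * Real.log (K / ε) / ε ^ 2 = 100 * (K * Real.log (K / ε) / ε ^ 2) := by
      ring
    rw [h4]
    linarith
  set κ := ε / (64 * K) with hκdef
  have hκ : 0 < κ := by positivity
  have hat' : ∀ x, p.real {x} ≤ κ := fun x => by
    refine ENNReal.toReal_le_of_le_ofReal hκ.le ((hat x).trans_eq ?_)
    rw [hκdef, hKdef, mul_assoc]
  set k := (2 * t + 3) * (d + 1) with hkdef
  have hk : (k : ℝ) ≤ 5 * K := by
    rw [hkdef, hKdef]
    push_cast
    nlinarith [Nat.cast_nonneg (α := ℝ) d]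
  have hinv : 1 / κ = 64 * (K / ε) := by
    rw [hκdef]
    field_simp
  have hkκ : k * (4 * κ) ≤ ε := by
    calc k * (4 * κ) ≤ 5 * K * (4 * κ) := by gcongr
      _ = 20 / 64 * ε := by
        rw [hκdef]
        field_simp
        norm_num
      _ ≤ ε := by linarith
  set G := {s : Fin m → ℝ | ∀ S, IsIntervalUnion k S → |empFreq s S - p.real S| ≤ ε + k * (4 * κ)}
  have hGc : (samples p m).real Gᶜ ≤ 1 / 10 :=
    (measureReal_not_uniform_le p hκ hat' hm0 hε.le k).trans
      (union_bound_le_one_tenth hK hε hR rfl hk (by positivity) (by rw [hinv]; linarith) hmle)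
  have hG : 9 / 10 ≤ (samples p m).real G := by
    have h := measureReal_union_le (μ := samples p m) G Gᶜ
    rw [union_compl_self, probReal_univ] at h
    linarith
  have hsub : G ⊆ {s | IsPiecewisePolyDist (A s) (-1) 1 (2 * t - 1) d ∧
      tvDist p (A s) ≤ 3 * optTD p t d * (1 + ε) + 100 * ε} := fun s hs => by
    have h1 := hAtv p s _ hs
    have h2 : 0 ≤ optTD p t d * ε := mul_nonneg (optTD_nonneg p t d) hε.le
    exact ⟨(hA s).mono_pieces hle, by linarith⟩
  calc (9 / 10 : ℝ≥0∞) = ENNReal.ofReal (9 / 10) := by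
        rw [ENNReal.ofReal_div_of_pos (by norm_num)]
        norm_num
    _ ≤ ENNReal.ofReal ((samples p m).real G) := ENNReal.ofReal_le_ofReal hG
    _ = samples p m G := ofReal_measureReal
    _ ≤ _ := measure_mono hsub
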